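/- The polynomial f(x) = (x^3 − 7)(x^3 − 251)(x^3 − 7·251)(x^3 − 7^2·251) = (x^3 − 7)(x^3 − 251)(x^3 − 1757)(x^3 − 12299) has a root modulo every positive integer; that is, for every integer m ≥ 1 there exists x ∈ ℤ with m dividing f(x). -/

import Mathlib

/-- Hensel lifting for cube roots modulo powers of a prime `p` not dividing `3 * a`. -/
theorem exists_cube_sub_dvd_prime_pow {p : ℕ} (hp : p.Prime) (h3 : ¬ (p : ℤ) ∣ 3) {a : ℤ}
    (ha : ¬ (p : ℤ) ∣ a) (h : ∃ x : ℤ, (p : ℤ) ∣ x ^ 3 - a) (k : ℕ) :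
    ∃ x : ℤ, (p : ℤ) ^ (k + 1) ∣ x ^ 3 - a := by
  induction k with
  | zero => simpa using h
  | succ k ih =>
    obtain ⟨x, c, hc⟩ := ih
    have hpZ : Prime (p : ℤ) := Nat.prime_iff_prime_int.mp hp
    have hx : ¬ (p : ℤ) ∣ x := fun hx => ha <| by
      have h1 : (p : ℤ) ∣ x ^ 3 - a := hc ▸ (dvd_pow_self _ k.succ_ne_zero).mul_right c
      exact (dvd_sub_right (dvd_pow hx three_ne_zero)).mp h1
    have hx2 : ¬ (p : ℤ) ∣ 3 * x ^ 2 := fun h => by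
      rcases hpZ.dvd_or_dvd h with h | h
      · exact h3 h
      · exact hx (hpZ.dvd_of_dvd_pow h)
    obtain ⟨u, v, huv⟩ := hpZ.coprime_iff_not_dvd.mpr hx2
    refine ⟨x - c * v * p ^ (k + 1), c * u + 3 * x * c ^ 2 * v ^ 2 * p ^ k
      - c ^ 3 * v ^ 3 * p ^ k * p ^ (k + 1), ?_⟩
    linear_combination hc - c * (p : ℤ) ^ (k + 1) * huv

/-- Hensel lifting for cube roots modulo powers of `3`, starting from modulus `9`. -/
theorem exists_cube_sub_dvd_three_pow {a : ℤ} (ha : ¬ (3 : ℤ) ∣ a)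
    (h : ∃ x : ℤ, 9 ∣ x ^ 3 - a) (k : ℕ) :
    ∃ x : ℤ, (3 : ℤ) ^ (k + 2) ∣ x ^ 3 - a := by
  induction k with
  | zero => simpa using h
  | succ k ih =>
    obtain ⟨x, c, hc⟩ := ih
    have hx : ¬ (3 : ℤ) ∣ x := fun hx => ha <| by
      have h1 : (3 : ℤ) ∣ x ^ 3 - a := hc ▸ (dvd_pow_self _ (by omega)).mul_right c
      exact (dvd_sub_right (dvd_pow hx three_ne_zero)).mp h1
    have hx2 : ¬ (3 : ℤ) ∣ x ^ 2 := fun h => hx (Int.prime_three.dvd_of_dvd_pow h)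
    obtain ⟨u, v, huv⟩ := Int.prime_three.coprime_iff_not_dvd.mpr hx2
    refine ⟨x - c * v * 3 ^ (k + 1), c * u + x * c ^ 2 * v ^ 2 * 3 ^ k
      - c ^ 3 * v ^ 3 * 3 ^ k * 3 ^ k, ?_⟩
    linear_combination hc - c * (3 : ℤ) ^ (k + 2) * huv

/-- In a cyclic group, one of `a`, `b`, `a * b`, `a ^ 2 * b` is a cube. -/
theorem IsCyclic.exists_cube_eq {G : Type*} [Group G] [IsCyclic G] (a b : G) :
    (∃ x, x ^ 3 = a) ∨ (∃ x, x ^ 3 = b) ∨ (∃ x, x ^ 3 = a * b) ∨ ∃ x, x ^ 3 = a ^ 2 * b := by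
  obtain ⟨g, hg⟩ := IsCyclic.exists_generator (α := G)
  obtain ⟨i, rfl⟩ := Subgroup.mem_zpowers_iff.mp (hg a)
  obtain ⟨j, rfl⟩ := Subgroup.mem_zpowers_iff.mp (hg b)
  have key : ∀ n : ℤ, 3 ∣ n → ∃ x : G, x ^ 3 = g ^ n := by
    rintro _ ⟨n, rfl⟩
    exact ⟨g ^ n, by rw [← zpow_natCast, ← zpow_mul, mul_comm]; rfl⟩
  have h : 3 ∣ i ∨ 3 ∣ j ∨ 3 ∣ i + j ∨ 3 ∣ i * 2 + j := by
    obtain hi | hi | hi : i % 3 = 0 ∨ i % 3 = 1 ∨ i % 3 = 2 := by omega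
    all_goals omega
  have h2 : (g ^ i) ^ 2 * g ^ j = g ^ (i * 2 + j) := by
    rw [zpow_add, zpow_mul, zpow_ofNat]
  rw [h2, ← zpow_add]
  exact h.imp (key _) (Or.imp (key _) (Or.imp (key _) (key _)))

/-- Modulo a prime dividing neither `a` nor `b`, one of `a`, `b`, `a * b`, `a ^ 2 * b`
is a cube. -/
theorem exists_prime_dvd_cube_sub {p : ℕ} (hp : p.Prime) {a b : ℤ} (ha : ¬ (p : ℤ) ∣ a)
    (hb : ¬ (p : ℤ) ∣ b) :
    (∃ x : ℤ, (p : ℤ) ∣ x ^ 3 - a) ∨ (∃ x : ℤ, (p : ℤ) ∣ x ^ 3 - b) ∨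
      (∃ x : ℤ, (p : ℤ) ∣ x ^ 3 - a * b) ∨ ∃ x : ℤ, (p : ℤ) ∣ x ^ 3 - a ^ 2 * b := by
  have := Fact.mk hp
  have ha' : (a : ZMod p) ≠ 0 := by rwa [Ne, ZMod.intCast_zmod_eq_zero_iff_dvd]
  have hb' : (b : ZMod p) ≠ 0 := by rwa [Ne, ZMod.intCast_zmod_eq_zero_iff_dvd]
  have key : ∀ (c : ℤ) (u : (ZMod p)ˣ), (u : ZMod p) = c → (∃ x, x ^ 3 = u) →
      ∃ x : ℤ, (p : ℤ) ∣ x ^ 3 - c := by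
    rintro c _ hc ⟨x, rfl⟩
    obtain ⟨y, hy⟩ := ZMod.intCast_surjective (x : ZMod p)
    refine ⟨y, (ZMod.intCast_zmod_eq_zero_iff_dvd _ p).mp ?_⟩
    push_cast at hc ⊢
    rw [hy, hc, sub_self]
  exact (IsCyclic.exists_cube_eq (Units.mk0 _ ha') (Units.mk0 _ hb')).imp (key _ _ (by simp))
    (Or.imp (key _ _ (by simp)) (Or.imp (key _ _ (by simp)) (key _ _ (by simp))))

/-- An integer polynomial with a root modulo every prime power has a root modulo every positive
integer. -/
theorem Polynomial.exists_dvd_eval_of_prime_pow (f : Polynomial ℤ)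
    (h : ∀ p n : ℕ, p.Prime → ∃ x : ℤ, (p : ℤ) ^ (n + 1) ∣ f.eval x) (m : ℕ) (hm : 1 ≤ m) :
    ∃ x : ℤ, (m : ℤ) ∣ f.eval x := by
  induction m using Nat.recOnPosPrimePosCoprime with
  | zero => omega
  | one => simp
  | prime_pow p n hp hn =>
    obtain ⟨k, rfl⟩ := Nat.exists_eq_add_of_lt hn
    simpa using h p k hp
  | coprime a b ha hb hab iha ihb =>
    obtain ⟨x, hx⟩ := iha ha.le
    obtain ⟨y, hy⟩ := ihb hb.le
    have hab' : IsCoprime (a : ℤ) b := Nat.isCoprime_iff_coprime.mpr hab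
    obtain ⟨u, v, huv⟩ := id hab'
    refine ⟨x * (v * b) + y * (u * a), ?_⟩
    rw [Nat.cast_mul]
    refine hab'.mul_dvd ?_ ?_
    · refine (dvd_iff_dvd_of_dvd_sub (dvd_trans ?_ (f.sub_dvd_eval_sub _ x))).mpr hx
      exact ⟨(y - x) * u, by linear_combination x * huv⟩
    · refine (dvd_iff_dvd_of_dvd_sub (dvd_trans ?_ (f.sub_dvd_eval_sub _ y))).mpr hy
      exact ⟨(x - y) * v, by linear_combination y * huv⟩

/-- The polynomial `(x³-7)(x³-251)(x³-1757)(x³-12299)` has a root modulo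
every prime power. -/
theorem exists_prime_pow_dvd {p : ℕ} (hp : p.Prime) (n : ℕ) :
    ∃ x : ℤ, (p : ℤ) ^ (n + 1) ∣
      (x ^ 3 - 7) * (x ^ 3 - 251) * (x ^ 3 - 1757) * (x ^ 3 - 12299) := by
  have h7 : (∃ x : ℤ, (p : ℤ) ^ (n + 1) ∣ x ^ 3 - 7) → ∃ x : ℤ, (p : ℤ) ^ (n + 1) ∣
      (x ^ 3 - 7) * (x ^ 3 - 251) * (x ^ 3 - 1757) * (x ^ 3 - 12299) :=
    fun ⟨x, hx⟩ => ⟨x, ((hx.mul_right _).mul_right _).mul_right _⟩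
  have h251 : (∃ x : ℤ, (p : ℤ) ^ (n + 1) ∣ x ^ 3 - 251) → ∃ x : ℤ, (p : ℤ) ^ (n + 1) ∣
      (x ^ 3 - 7) * (x ^ 3 - 251) * (x ^ 3 - 1757) * (x ^ 3 - 12299) :=
    fun ⟨x, hx⟩ => ⟨x, ((hx.mul_left _).mul_right _).mul_right _⟩
  have prime_251 : Nat.Prime 251 := by norm_num
  by_cases hp3 : p = 3
  · subst hp3
    obtain ⟨x, hx⟩ := exists_cube_sub_dvd_three_pow (a := 251) (by norm_num) ⟨2, by norm_num⟩ n
    exact h251 ⟨x, (pow_dvd_pow 3 (Nat.le_succ _)).trans hx⟩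
  have not_dvd : ∀ {q : ℕ}, q.Prime → p ≠ q → ¬ (p : ℤ) ∣ q := fun hq hne h =>
    hne ((Nat.prime_dvd_prime_iff_eq hp hq).mp (Int.natCast_dvd_natCast.mp h))
  have h3 : ¬ (p : ℤ) ∣ 3 := not_dvd Nat.prime_three hp3
  by_cases hp7 : p = 7
  · subst hp7
    exact h251 (exists_cube_sub_dvd_prime_pow hp h3 (by norm_num) ⟨3, by norm_num⟩ n)
  by_cases hp251 : p = 251
  · subst hp251
    exact h7 (exists_cube_sub_dvd_prime_pow hp h3 (by norm_num) ⟨88, by norm_num⟩ n)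
  have hn7 : ¬ (p : ℤ) ∣ 7 := not_dvd Nat.prime_seven hp7
  have hn251 : ¬ (p : ℤ) ∣ 251 := not_dvd prime_251 hp251
  have hpZ : Prime (p : ℤ) := Nat.prime_iff_prime_int.mp hp
  rcases exists_prime_dvd_cube_sub hp hn7 hn251 with h | h | h | h
  · exact h7 (exists_cube_sub_dvd_prime_pow hp h3 hn7 h n)
  · exact h251 (exists_cube_sub_dvd_prime_pow hp h3 hn251 h n)
  · obtain ⟨x, hx⟩ := exists_cube_sub_dvd_prime_pow hp h3 (hpZ.not_dvd_mul hn7 hn251) h n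
    norm_num at hx
    exact ⟨x, (hx.mul_left _).mul_right _⟩
  · obtain ⟨x, hx⟩ := exists_cube_sub_dvd_prime_pow hp h3
      (hpZ.not_dvd_mul (mt hpZ.dvd_of_dvd_pow hn7) hn251) h n
    norm_num at hx
    exact ⟨x, hx.mul_left _⟩

/-- The polynomial `(x³-7)(x³-251)(x³-1757)(x³-12299)` has a root modulo
every positive integer. -/
theorem stmt15 :
    ∀ m : ℕ, 1 ≤ m → ∃ x : ℤ,
      (m : ℤ) ∣ (x ^ 3 - 7) * (x ^ 3 - 251) * (x ^ 3 - 1757) * (x ^ 3 - 12299) := by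
  intro m hm
  open Polynomial in
  have h := exists_dvd_eval_of_prime_pow
    ((X ^ 3 - C 7) * (X ^ 3 - C 251) * (X ^ 3 - C 1757) * (X ^ 3 - C 12299) : ℤ[X])
    (fun p n hp => by
      simpa only [eval_mul, eval_sub, eval_pow, eval_X, eval_C] using exists_prime_pow_dvd hp n)
    m hm
  simpa only [Polynomial.eval_mul, Polynomial.eval_sub, Polynomial.eval_pow, Polynomial.eval_X,
    Polynomial.eval_C] using h
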